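/- arXiv:0910.3888 — 3 statements merged into one kernel-verified Lean document; each statement's English description precedes it below -/
import Mathlib

section
/- (Local determination of ultrapowers.) Let E be a Banach space over 𝕜 (𝕜 = ℝ or ℂ), I a nonempty index set, 𝔘 an ultrafilter on I, and let M be a nonzero finite-dimensional linear subspace of the ultrapower (E)_𝔘. Then there exists a family of continuous linear operators R_i : M → E (i ∈ I) such that: (1) for every z ∈ M, the family (R_i z)_{i∈I} is bounded and q_E((R_i z)_{i∈I}) = z; (2) ‖R_i‖ ≤ 1 for all i ∈ I, and there is a set U ∈ 𝔘 with ‖R_i‖ = 1 for all i ∈ U; (3) for every ε > 0 there is a set U_ε ∈ 𝔘 such that for all i ∈ U_ε the operator R_i is injective and its inverse R_i^{-1} : R_i(M) → M satisfies ‖R_i^{-1}‖ ≤ 1 + ε. -/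
set_option synthInstance.maxHeartbeats 1000000
set_option maxHeartbeats 1000000

open Filter Topology ENNReal NormedSpace

noncomputable section

variable (𝕜 : Type*) [RCLike 𝕜]

/-- The Banach space `ℓ∞(I, E)` of bounded families in `E` indexed by `I`,
with the supremum norm. -/
abbrev BoundedFamilies (I E : Type*) [NormedAddCommGroup E] : Type _ :=
  lp (fun _ : I => E) ⊤

/-- The constant family `(x)_{i ∈ I}`, as an element of `ℓ∞(I, E)`. -/
def constFamily (I : Type*) {E : Type*} [NormedAddCommGroup E] (x : E) :
    BoundedFamilies I E :=
  ⟨fun _ => x, memℓp_infty ⟨‖x‖, by rintro r ⟨i, rfl⟩; exact le_rfl⟩⟩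

/-- The subspace `N_𝔘 = {x ∈ ℓ∞(I,E) : lim_{i,𝔘} ‖x_i‖ = 0}`. -/
def ultraNullSubmodule (I : Type*) (𝔘 : Ultrafilter I) (E : Type*) [NormedAddCommGroup E]
    [NormedSpace 𝕜 E] : Submodule 𝕜 (BoundedFamilies I E) where
  carrier := {x | Tendsto (fun i => ‖x i‖) (𝔘 : Filter I) (𝓝 0)}
  zero_mem' := by
    simpa [lp.coeFn_zero] using (tendsto_const_nhds :
      Tendsto (fun _ : I => (0 : ℝ)) (𝔘 : Filter I) (𝓝 0))
  add_mem' := by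
    intro x y hx hy
    refine squeeze_zero (fun i => norm_nonneg _) (fun i => ?_) (by simpa using hx.add hy)
    have : (↑(x + y) : ∀ _ : I, _) = fun i => x i + y i := by
      rw [lp.coeFn_add]; rfl
    rw [this]
    exact norm_add_le _ _
  smul_mem' := by
    intro c x hx
    have h := hx.const_mul ‖c‖
    refine squeeze_zero (fun i => norm_nonneg _) (fun i => ?_) (by simpa using h)
    have : (↑(c • x) : ∀ _ : I, _) = fun i => c • x i := by
      rw [lp.coeFn_smul]; rfl
    rw [this]
    simp [norm_smul]

/-- The ultrapower `(E)_𝔘 = ℓ∞(I,E) / N_𝔘`, with the quotient norm. -/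
abbrev Ultrapower (I : Type*) (𝔘 : Ultrafilter I) (E : Type*) [NormedAddCommGroup E]
    [NormedSpace 𝕜 E] : Type _ :=
  BoundedFamilies I E ⧸ ultraNullSubmodule 𝕜 I 𝔘 E

/-- The quotient map `q_E : ℓ∞(I,E) → (E)_𝔘`. -/
def ultrapowerQuot (I : Type*) (𝔘 : Ultrafilter I) (E : Type*) [NormedAddCommGroup E]
    [NormedSpace 𝕜 E] (x : BoundedFamilies I E) : Ultrapower 𝕜 I 𝔘 E :=
  Submodule.Quotient.mk (p := ultraNullSubmodule 𝕜 I 𝔘 E) x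

/-- The canonical embedding `h_E : E → (E)_𝔘`, sending `x` to the class of the
constant family `(x)_{i ∈ I}`. -/
def diagonalEmbedding (I : Type*) (𝔘 : Ultrafilter I) (E : Type*) [NormedAddCommGroup E]
    [NormedSpace 𝕜 E] (x : E) : Ultrapower 𝕜 I 𝔘 E :=
  ultrapowerQuot 𝕜 I 𝔘 E (constFamily I x)

/-- The norm of a class in the ultrapower is the limit along the ultrafilter of the norms of
the members of any representing family. -/
theorem tendsto_norm_ultrapowerQuot {I E : Type*} (𝔘 : Ultrafilter I) [NormedAddCommGroup E]
    [NormedSpace 𝕜 E] (x : BoundedFamilies I E) :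
    Tendsto (fun i => ‖x i‖) 𝔘 (𝓝 ‖ultrapowerQuot 𝕜 I 𝔘 E x‖) := by
  classical
  refine tendsto_order.2 ⟨fun a ha => ?_, fun a ha => ?_⟩
  · by_contra h
    rw [← Ultrafilter.eventually_not] at h
    simp only [not_lt] at h
    obtain ⟨b, hab, hb⟩ := exists_between ha
    let y : BoundedFamilies I E := ⟨fun i => if ‖x i‖ ≤ a then x i else 0, by
      refine memℓp_infty ⟨‖x‖, ?_⟩
      rintro _ ⟨i, rfl⟩
      dsimp only
      split_ifs
      · exact lp.norm_apply_le_norm top_ne_zero x i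
      · simp⟩
    have ha0 : 0 ≤ a := by
      obtain ⟨i, hi⟩ := h.exists
      exact (norm_nonneg _).trans hi
    have hy : ‖y‖ ≤ a := by
      refine lp.norm_le_of_forall_le ha0 fun i => ?_
      change ‖(if ‖x i‖ ≤ a then x i else 0 : E)‖ ≤ a
      split_ifs with hi
      · exact hi
      · simpa using ha0
    have hxy : ultrapowerQuot 𝕜 I 𝔘 E x = ultrapowerQuot 𝕜 I 𝔘 E y := by
      refine (Submodule.Quotient.eq _).2 ?_
      refine (tendsto_congr' ?_).2 tendsto_const_nhds
      filter_upwards [h] with i hi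
      change ‖x i - (if ‖x i‖ ≤ a then x i else 0 : E)‖ = 0
      simp [hi]
    have := Submodule.Quotient.norm_mk_le (S := ultraNullSubmodule 𝕜 I 𝔘 E) y
    change ‖ultrapowerQuot 𝕜 I 𝔘 E y‖ ≤ ‖y‖ at this
    rw [← hxy] at this
    linarith
  · obtain ⟨y, hy, hya⟩ := Submodule.Quotient.norm_mk_lt
      (ultrapowerQuot 𝕜 I 𝔘 E x) (sub_pos.2 ha)
    have hxy : Tendsto (fun i => ‖(x - y) i‖) 𝔘 (𝓝 0) :=
      (Submodule.Quotient.eq (ultraNullSubmodule 𝕜 I 𝔘 E)).1 hy.symm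
    have hlt : ‖y‖ < a := by linarith
    filter_upwards [hxy.eventually (gt_mem_nhds (sub_pos.2 hlt))] with i hi
    have h1 : ‖x i‖ ≤ ‖x i - y i‖ + ‖y i‖ := by
      simpa using norm_add_le (x i - y i) (y i)
    have h2 : ‖y i‖ ≤ ‖y‖ := lp.norm_apply_le_norm top_ne_zero y i
    have h3 : ‖x i - y i‖ < a - ‖y‖ := hi
    linarith

theorem isClosed_ultraNullSubmodule {I E : Type*} (𝔘 : Ultrafilter I) [NormedAddCommGroup E]
    [NormedSpace 𝕜 E] :
    IsClosed (ultraNullSubmodule 𝕜 I 𝔘 E : Set (BoundedFamilies I E)) := by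
  have hcont : Continuous (fun x => ‖ultrapowerQuot 𝕜 I 𝔘 E x‖) :=
    continuous_norm.comp (ultraNullSubmodule 𝕜 I 𝔘 E).continuous_mkQ
  convert isClosed_singleton.preimage hcont (t := {0}) using 1
  ext x
  have hx := tendsto_norm_ultrapowerQuot 𝕜 𝔘 x
  exact ⟨fun h => tendsto_nhds_unique hx h, fun h => by
    rw [Set.mem_preimage, Set.mem_singleton_iff] at h
    rwa [h] at hx⟩

theorem exists_norm_map_le_of_finiteDimensional {I E V : Type*} [SeminormedAddCommGroup V]
    [NormedSpace 𝕜 V] [T2Space V] [FiniteDimensional 𝕜 V] [NormedAddCommGroup E]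
    [NormedSpace 𝕜 E] (f : V →ₗ[𝕜] BoundedFamilies I E) : ∃ C : ℝ, ∀ z, ‖f z‖ ≤ C * ‖z‖ :=
  ⟨‖f.toContinuousLinearMap‖, f.toContinuousLinearMap.le_opNorm⟩

/-- A uniformly bounded family of operators on a proper space which is pointwise asymptotically
norm preserving along an ultrafilter is so uniformly on the unit ball. -/
theorem eventually_abs_norm_sub_norm_le {I V F : Type*} (𝔘 : Ultrafilter I)
    [SeminormedAddCommGroup V] [NormedSpace 𝕜 V] [ProperSpace V]
    [SeminormedAddCommGroup F] [NormedSpace 𝕜 F] (T : I → V →L[𝕜] F) {C : ℝ}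
    (hC : ∀ i z, ‖T i z‖ ≤ C * ‖z‖)
    (hT : ∀ z, Tendsto (fun i => ‖T i z‖) 𝔘 (𝓝 ‖z‖)) {δ : ℝ} (hδ : 0 < δ) :
    ∀ᶠ i in 𝔘, ∀ z, |‖T i z‖ - ‖z‖| ≤ δ * ‖z‖ := by
  by_contra h
  rw [← Ultrafilter.eventually_not] at h
  have hsphere : ∀ᶠ i in 𝔘, ∃ w : V, ‖w‖ = 1 ∧ δ < |‖T i w‖ - 1| := by
    filter_upwards [h] with i hi
    push Not at hi
    obtain ⟨z, hz⟩ := hi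
    have hz0 : 0 < ‖z‖ := by
      refine (norm_nonneg z).lt_of_ne' fun h0 => ?_
      have := hC i z
      rw [h0, mul_zero] at this
      have h1 : ‖T i z‖ = 0 := le_antisymm this (norm_nonneg _)
      simp [h0, h1] at hz
    refine ⟨((‖z‖⁻¹ : ℝ) : 𝕜) • z, ?_, ?_⟩
    · rw [norm_smul, RCLike.norm_ofReal, abs_of_pos (inv_pos.2 hz0), inv_mul_cancel₀ hz0.ne']
    · rw [map_smul, norm_smul, RCLike.norm_ofReal, abs_of_pos (inv_pos.2 hz0)]
      have : ‖z‖⁻¹ * ‖T i z‖ - 1 = ‖z‖⁻¹ * (‖T i z‖ - ‖z‖) := by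
        field_simp
      rw [this, abs_mul, abs_of_pos (inv_pos.2 hz0), inv_mul_eq_div, lt_div_iff₀ hz0]
      exact hz
  obtain ⟨w, hw⟩ := hsphere.choice
  obtain ⟨z, hz, hwz⟩ := (isCompact_sphere (0 : V) 1).ultrafilter_le_nhds (𝔘.map w) (by
    rw [le_principal_iff, Ultrafilter.mem_coe, Ultrafilter.mem_map]
    filter_upwards [hw] with i hi
    simpa using hi.1)
  have hwz : Tendsto w 𝔘 (𝓝 z) := hwz
  have hz : ‖z‖ = 1 := by simpa using hz
  have hdist : Tendsto (fun i => C * ‖w i - z‖) 𝔘 (𝓝 0) := by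
    simpa using (tendsto_iff_norm_sub_tendsto_zero.1 hwz).const_mul C
  have hdiff : Tendsto (fun i => ‖T i (w i)‖ - ‖T i z‖) 𝔘 (𝓝 0) := by
    refine squeeze_zero_norm (fun i => ?_) hdist
    calc |‖T i (w i)‖ - ‖T i z‖| ≤ ‖T i (w i) - T i z‖ := abs_norm_sub_norm_le _ _
      _ = ‖T i (w i - z)‖ := by rw [map_sub]
      _ ≤ C * ‖w i - z‖ := hC i _
  have hlim : Tendsto (fun i => |‖T i (w i)‖ - 1|) 𝔘 (𝓝 0) := by
    have := ((hdiff.add (hT z)).sub_const 1).abs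
    simpa [hz] using this
  obtain ⟨i, hi, hi'⟩ := (hw.and (hlim.eventually (gt_mem_nhds hδ))).exists
  exact lt_asymm hi.2 hi'

theorem tendsto_opNorm_one {I V F : Type*} (𝔘 : Ultrafilter I)
    [SeminormedAddCommGroup V] [NormedSpace 𝕜 V]
    [SeminormedAddCommGroup F] [NormedSpace 𝕜 F] (T : I → V →L[𝕜] F) {v : V} (hv : ‖v‖ ≠ 0)
    (hT : ∀ δ : ℝ, 0 < δ → ∀ᶠ i in 𝔘, ∀ z, |‖T i z‖ - ‖z‖| ≤ δ * ‖z‖) :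
    Tendsto (fun i => ‖T i‖) 𝔘 (𝓝 1) := by
  refine Metric.tendsto_nhds.2 fun ε hε => ?_
  filter_upwards [hT (ε / 2) (half_pos hε)] with i hi
  have hup : ‖T i‖ ≤ 1 + ε / 2 :=
    (T i).opNorm_le_bound (by positivity) fun z => by linarith [(abs_le.1 (hi z)).2]
  have hv0 : 0 < ‖v‖ := (norm_nonneg v).lt_of_ne' hv
  have hlow : 1 - ε / 2 ≤ ‖T i‖ := by
    refine le_of_mul_le_mul_right ?_ hv0
    linarith [(abs_le.1 (hi v)).1, (T i).le_opNorm v]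
  rw [Real.dist_eq, abs_lt]
  constructor <;> linarith

/-- A uniformly bounded family of operators on a proper space which is pointwise asymptotically
norm preserving along an ultrafilter is asymptotic to a family of contractions which are
eventually of norm one and eventually `(1 + ε)`-bounded below. -/
theorem exists_contractions_of_tendsto_norm {I V F : Type*} (𝔘 : Ultrafilter I)
    [SeminormedAddCommGroup V] [NormedSpace 𝕜 V] [ProperSpace V]
    [SeminormedAddCommGroup F] [NormedSpace 𝕜 F] (T : I → V →L[𝕜] F) {C : ℝ}
    (hC : ∀ i z, ‖T i z‖ ≤ C * ‖z‖)
    (hTz : ∀ z, Tendsto (fun i => ‖T i z‖) 𝔘 (𝓝 ‖z‖)) {v : V} (hv : ‖v‖ ≠ 0) :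
    ∃ R : I → V →L[𝕜] F,
      (∀ z, Tendsto (fun i => ‖R i z - T i z‖) 𝔘 (𝓝 0)) ∧
      (∀ i, ‖R i‖ ≤ 1) ∧ (∀ᶠ i in 𝔘, ‖R i‖ = 1) ∧
      ∀ ε : ℝ, 0 < ε → ∀ᶠ i in 𝔘, ∀ z, ‖z‖ ≤ (1 + ε) * ‖R i z‖ := by
  have hT (δ : ℝ) (hδ : 0 < δ) : ∀ᶠ i in 𝔘, ∀ z, |‖T i z‖ - ‖z‖| ≤ δ * ‖z‖ :=
    eventually_abs_norm_sub_norm_le 𝕜 𝔘 T hC hTz hδ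
  have hnorm : Tendsto (fun i => ‖T i‖) 𝔘 (𝓝 1) := tendsto_opNorm_one 𝕜 𝔘 T hv hT
  have hpos : ∀ᶠ i in 𝔘, 0 < ‖T i‖ := hnorm.eventually (lt_mem_nhds one_pos)
  have hinv (i : I) : ‖((‖T i‖⁻¹ : ℝ) : 𝕜)‖ = ‖T i‖⁻¹ := by
    rw [RCLike.norm_ofReal, abs_of_nonneg (inv_nonneg.2 (norm_nonneg _))]
  let R (i : I) : V →L[𝕜] F := ((‖T i‖⁻¹ : ℝ) : 𝕜) • T i
  have hRz (i : I) (z : V) : ‖R i z‖ = ‖T i‖⁻¹ * ‖T i z‖ := by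
    change ‖((‖T i‖⁻¹ : ℝ) : 𝕜) • T i z‖ = _
    rw [norm_smul, hinv]
  have hR (i : I) : ‖R i‖ = ‖T i‖⁻¹ * ‖T i‖ := by
    rw [norm_smul, hinv]
  refine ⟨R, fun z => ?_, fun i => ?_, ?_, fun ε hε => ?_⟩
  · have hlim : Tendsto (fun i => |‖T i‖⁻¹ - 1| * ‖T i z‖) 𝔘 (𝓝 0) := by
      simpa using ((hnorm.inv₀ one_ne_zero).sub_const 1).abs.mul (hTz z)
    refine hlim.congr fun i => ?_
    have : R i z - T i z = ((‖T i‖⁻¹ - 1 : ℝ) : 𝕜) • T i z := by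
      rw [RCLike.ofReal_sub, RCLike.ofReal_one, sub_smul, one_smul]
      rfl
    rw [this, norm_smul, RCLike.norm_ofReal]
  · rw [hR]
    exact inv_mul_le_one
  · filter_upwards [hpos] with i hi
    rw [hR, inv_mul_cancel₀ hi.ne']
  · have hδ : 0 < ε / (2 + ε) := by positivity
    filter_upwards [hpos, hT _ hδ] with i hi0 hi z
    have hup : ‖T i‖ ≤ 1 + ε / (2 + ε) :=
      (T i).opNorm_le_bound (by positivity) fun z => by linarith [(abs_le.1 (hi z)).2]
    have h1 : (1 - ε / (2 + ε)) * ‖z‖ ≤ ‖T i z‖ := by linarith [(abs_le.1 (hi z)).1]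
    have h2 : ‖T i z‖ ≤ (1 + ε / (2 + ε)) * ‖R i z‖ := by
      calc ‖T i z‖ = ‖T i‖ * ‖R i z‖ := by rw [hRz, mul_inv_cancel_left₀ hi0.ne']
        _ ≤ _ := by gcongr
    have h3 : 1 - ε / (2 + ε) = 2 / (2 + ε) := by field_simp; ring
    have h4 : 1 + ε / (2 + ε) = 2 / (2 + ε) * (1 + ε) := by field_simp; ring
    rw [h4, mul_assoc] at h2
    rw [h3] at h1
    exact le_of_mul_le_mul_left (h1.trans h2) (by positivity)

/-- Local determination of ultrapowers. -/
theorem localDetermination_of_ultrapowers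
    (𝕜 : Type*) [RCLike 𝕜] (I : Type*) [Nonempty I] (𝔘 : Ultrafilter I)
    (E : Type*) [NormedAddCommGroup E] [NormedSpace 𝕜 E] [CompleteSpace E]
    (M : Submodule 𝕜 (Ultrapower 𝕜 I 𝔘 E)) (hM : M ≠ ⊥) [FiniteDimensional 𝕜 M] :
    ∃ R : I → (M →L[𝕜] E),
      (∀ z : M, ∃ hb : Memℓp (fun i => R i z) ⊤,
        ultrapowerQuot 𝕜 I 𝔘 E ⟨fun i => R i z, hb⟩ = (z : Ultrapower 𝕜 I 𝔘 E)) ∧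
      ((∀ i, ‖R i‖ ≤ 1) ∧ ∃ U ∈ 𝔘, ∀ i ∈ U, ‖R i‖ = 1) ∧
      (∀ ε : ℝ, 0 < ε → ∃ Uε ∈ 𝔘, ∀ i ∈ Uε, Function.Injective (R i) ∧
        ∀ z : M, ‖(z : Ultrapower 𝕜 I 𝔘 E)‖ ≤ (1 + ε) * ‖R i z‖) := by
  have hclosed := isClosed_ultraNullSubmodule 𝕜 (E := E) 𝔘
  have : T3Space (Ultrapower 𝕜 I 𝔘 E) := Submodule.t3_quotient_of_isClosed _
  have : ProperSpace M := FiniteDimensional.proper 𝕜 M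
  clear hclosed
  have hM0 (z : M) (hz : ‖z‖ = 0) : z = 0 := (inseparable_zero_iff_norm.2 hz).eq
  obtain ⟨g, hg⟩ := (ultraNullSubmodule 𝕜 I 𝔘 E).mkQ.exists_rightInverse_of_surjective
    (Submodule.range_mkQ _)
  let S : M →ₗ[𝕜] BoundedFamilies I E := g ∘ₗ M.subtype
  have hS (z : M) : ultrapowerQuot 𝕜 I 𝔘 E (S z) = z := LinearMap.congr_fun hg z
  let T (i : I) : M →L[𝕜] E := (lp.evalₗ (𝕜 := 𝕜) (fun _ : I => E) ⊤ i ∘ₗ S).toContinuousLinearMap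
  obtain ⟨C, hSC⟩ := exists_norm_map_le_of_finiteDimensional 𝕜 S
  have hC (i : I) (z : M) : ‖T i z‖ ≤ C * ‖z‖ :=
    (lp.norm_apply_le_norm top_ne_zero (S z) i).trans (hSC z)
  have hTz (z : M) : Tendsto (fun i => ‖T i z‖) 𝔘 (𝓝 ‖z‖) := by
    have := tendsto_norm_ultrapowerQuot 𝕜 𝔘 (S z)
    rwa [hS] at this
  obtain ⟨v, hvM, hv0⟩ := M.ne_bot_iff.1 hM
  obtain ⟨R, hRT, hR1, hR, hRε⟩ := exists_contractions_of_tendsto_norm 𝕜 𝔘 T hC hTz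
    (v := ⟨v, hvM⟩) fun h => hv0 (congrArg Subtype.val (hM0 _ h))
  refine ⟨R, fun z => ?_, ⟨hR1, _, hR, fun i hi => hi⟩, fun ε hε => ⟨_, hRε ε hε, fun i hi => ?_⟩⟩
  · have hb : Memℓp (fun i => R i z) ⊤ := by
      refine memℓp_infty ⟨‖z‖, ?_⟩
      rintro _ ⟨i, rfl⟩
      exact ((R i).le_of_opNorm_le (hR1 i) z).trans_eq (one_mul _)
    exact ⟨hb, ((Submodule.Quotient.eq _).2 (hRT z)).trans (hS z)⟩
  · refine ⟨(injective_iff_map_eq_zero (R i)).2 fun z hz => hM0 z ?_, hi⟩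
    have hzi : ‖z‖ ≤ (1 + ε) * ‖R i z‖ := hi z
    rw [hz, norm_zero, mul_zero] at hzi
    exact le_antisymm hzi (norm_nonneg z)
end
end

section
/- Let E be a Banach space over 𝕜 (𝕜 = ℝ or ℂ), I a nonempty index set, 𝔘 an ultrafilter on I, n ≥ 1, and A : E^n → 𝕜 a continuous n-linear form. Then there exists a unique continuous n-linear form Ā : ((E)_𝔘)^n → 𝕜 such that: (a) Ā(h_E x_1, …, h_E x_n) = A(x_1, …, x_n) for all x_1, …, x_n ∈ E; and (b) for every j with 1 ≤ j ≤ n, all x_1, …, x_{j−1} ∈ E, every bounded family y = (y_i)_{i∈I} in E, and all z_{j+1}, …, z_n ∈ (E)_𝔘, one has Ā(h_E x_1, …, h_E x_{j−1}, q_E y, z_{j+1}, …, z_n) = lim_{i,𝔘} Ā(h_E x_1, …, h_E x_{j−1}, h_E y_i, z_{j+1}, …, z_n). Moreover ‖Ā‖ = ‖A‖, where ‖·‖ denotes the norm of a continuous multilinear form. -/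
set_option synthInstance.maxHeartbeats 1000000
set_option maxHeartbeats 1000000

open Filter Topology ENNReal NormedSpace

noncomputable section

variable (𝕜 : Type*) [RCLike 𝕜]

/-- `Abar` is the *iterated extension* of the continuous `n`-linear form `A` to the
ultrapower `(E)_𝔘`: it agrees with `A` on (the image under `h_E` of) `E`, and it is
obtained by iterated limits along `𝔘`, one variable at a time, from the last variable
to the first. -/
def IsIteratedExtension {𝕜 : Type*} [RCLike 𝕜] {I : Type*} {𝔘 : Ultrafilter I}
    {E : Type*} [NormedAddCommGroup E] [NormedSpace 𝕜 E] {n : ℕ}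
    (A : ContinuousMultilinearMap 𝕜 (fun _ : Fin n => E) 𝕜)
    (Abar : ContinuousMultilinearMap 𝕜 (fun _ : Fin n => Ultrapower 𝕜 I 𝔘 E) 𝕜) : Prop :=
  (∀ x : Fin n → E, Abar (fun j => diagonalEmbedding 𝕜 I 𝔘 E (x j)) = A x) ∧
  (∀ (j : Fin n) (x : Fin n → E) (y : BoundedFamilies I E)
      (z : Fin n → Ultrapower 𝕜 I 𝔘 E),
    Tendsto
      (fun i => Abar (fun l => if l < j then diagonalEmbedding 𝕜 I 𝔘 E (x l)
        else if l = j then diagonalEmbedding 𝕜 I 𝔘 E (y i) else z l))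
      (𝔘 : Filter I)
      (𝓝 (Abar (fun l => if l < j then diagonalEmbedding 𝕜 I 𝔘 E (x l)
        else if l = j then ultrapowerQuot 𝕜 I 𝔘 E y else z l))))

section IteratedExtension

variable {𝕜}
variable {I E F : Type*} {𝔘 : Ultrafilter I}
  [NormedAddCommGroup E] [NormedSpace 𝕜 E] [SeminormedAddCommGroup F] [NormedSpace 𝕜 F]

lemma norm_constFamily_le (x : E) : ‖constFamily I x‖ ≤ ‖x‖ :=
  lp.norm_le_of_forall_le (norm_nonneg x) fun _ => le_rfl

lemma norm_ultrapowerQuot_le (y : BoundedFamilies I E) :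
    ‖ultrapowerQuot 𝕜 I 𝔘 E y‖ ≤ ‖y‖ :=
  Submodule.Quotient.norm_mk_le _ y

lemma norm_diagonalEmbedding_le (x : E) : ‖diagonalEmbedding 𝕜 I 𝔘 E x‖ ≤ ‖x‖ :=
  (norm_ultrapowerQuot_le _).trans (norm_constFamily_le x)

lemma exists_ultrapowerQuot_eq_norm_lt (z : Ultrapower 𝕜 I 𝔘 E) {ε : ℝ} (hε : 0 < ε) :
    ∃ y : BoundedFamilies I E, ultrapowerQuot 𝕜 I 𝔘 E y = z ∧ ‖y‖ < ‖z‖ + ε :=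
  QuotientAddGroup.exists_norm_mk_lt (S := (ultraNullSubmodule 𝕜 I 𝔘 E).toAddSubgroup) z hε

namespace IsIteratedExtension

variable {n : ℕ} {A B : ContinuousMultilinearMap 𝕜 (fun _ : Fin n => E) 𝕜}
  {Abar Bbar : ContinuousMultilinearMap 𝕜 (fun _ : Fin n => Ultrapower 𝕜 I 𝔘 E) 𝕜}

lemma add (hA : IsIteratedExtension A Abar) (hB : IsIteratedExtension B Bbar) :
    IsIteratedExtension (A + B) (Abar + Bbar) :=
  ⟨fun x => by simp [hA.1, hB.1], fun j x y z => (hA.2 j x y z).add (hB.2 j x y z)⟩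

lemma smul (c : 𝕜) (hA : IsIteratedExtension A Abar) :
    IsIteratedExtension (c • A) (c • Abar) :=
  ⟨fun x => by simp [hA.1], fun j x y z => (hA.2 j x y z).const_smul c⟩

lemma sub (hA : IsIteratedExtension A Abar) (hB : IsIteratedExtension B Bbar) :
    IsIteratedExtension (A - B) (Abar - Bbar) :=
  ⟨fun x => by simp [hA.1, hB.1], fun j x y z => (hA.2 j x y z).sub (hB.2 j x y z)⟩

/-- The norm bound on mixed arguments, with constant families in the first `k` variables. -/
lemma norm_apply_mixed_le (hA : IsIteratedExtension A Abar) {b : Fin n → ℝ}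
    {y : Fin n → BoundedFamilies I E} (hy : ∀ l, ‖y l‖ ≤ b l) {k : ℕ} (hk : k ≤ n) :
    ∀ x : Fin n → E, (∀ l, ‖x l‖ ≤ b l) →
      ‖Abar (fun l => if (l : ℕ) < k then diagonalEmbedding 𝕜 I 𝔘 E (x l)
        else ultrapowerQuot 𝕜 I 𝔘 E (y l))‖ ≤ ‖A‖ * ∏ l, b l := by
  induction hk using Nat.decreasingInduction with
  | self =>
    intro x hx
    simpa [hA.1] using A.le_opNorm_mul_prod_of_le hx
  | of_succ k hk ih =>
    intro x hx
    let j : Fin n := ⟨k, hk⟩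
    have hlim := (hA.2 j x (y j) (fun l => ultrapowerQuot 𝕜 I 𝔘 E (y l))).norm
    have harg : (fun l => if l < j then diagonalEmbedding 𝕜 I 𝔘 E (x l)
        else if l = j then ultrapowerQuot 𝕜 I 𝔘 E (y j) else ultrapowerQuot 𝕜 I 𝔘 E (y l)) =
        fun l : Fin n => if (l : ℕ) < k then diagonalEmbedding 𝕜 I 𝔘 E (x l)
          else ultrapowerQuot 𝕜 I 𝔘 E (y l) := by
      funext l
      rcases eq_or_ne l j with rfl | hl
      · simp [j]
      · simp [hl, Fin.lt_def, j]
    rw [harg] at hlim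
    refine le_of_tendsto hlim (Eventually.of_forall fun i => ?_)
    have hx' : ∀ l, ‖Function.update x j (y j i) l‖ ≤ b l := by
      intro l
      rcases eq_or_ne l j with rfl | hl
      · simpa using (lp.norm_apply_le_norm ENNReal.top_ne_zero (y j) i).trans (hy j)
      · simpa [hl] using hx l
    refine (congrArg (fun w => ‖Abar w‖) (funext fun l => ?_)).trans_le (ih _ hx')
    rcases lt_trichotomy l j with hl | rfl | hl
    · have : (l : ℕ) < k := hl
      simp [hl, hl.ne, this.trans (Nat.lt_succ_self k)]
    · simp [j]
    · have : ¬ (l : ℕ) < k + 1 := not_lt.2 (Nat.succ_le_of_lt hl)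
      simp [hl.not_gt, hl.ne', this]

lemma norm_le (hA : IsIteratedExtension A Abar) : ‖Abar‖ ≤ ‖A‖ := by
  refine Abar.opNorm_le_bound (norm_nonneg A) fun z => ?_
  have hlim : Tendsto (fun ε : ℝ => ‖A‖ * ∏ l, (‖z l‖ + ε)) (𝓝[>] 0)
      (𝓝 (‖A‖ * ∏ l, ‖z l‖)) := by
    have : Continuous fun ε : ℝ => ‖A‖ * ∏ l, (‖z l‖ + ε) := by fun_prop
    simpa using (this.tendsto 0).mono_left nhdsWithin_le_nhds
  refine ge_of_tendsto hlim ?_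
  filter_upwards [self_mem_nhdsWithin] with ε (hε : 0 < ε)
  choose y hyz hy using fun l => exists_ultrapowerQuot_eq_norm_lt (z l) hε
  have := hA.norm_apply_mixed_le (fun l => (hy l).le) (Nat.zero_le n) 0
    fun l => by simpa using add_nonneg (norm_nonneg (z l)) hε.le
  simpa [hyz] using this

lemma le_norm (hA : IsIteratedExtension A Abar) : ‖A‖ ≤ ‖Abar‖ :=
  A.opNorm_le_bound (norm_nonneg Abar) fun x => by
    rw [← hA.1]
    exact Abar.le_opNorm_mul_prod_of_le fun l => norm_diagonalEmbedding_le (x l)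

lemma unique (hA : IsIteratedExtension A Abar) (hB : IsIteratedExtension A Bbar) :
    Abar = Bbar := by
  have h := (hA.sub hB).norm_le
  rw [sub_self, norm_zero] at h
  exact sub_eq_zero.1 (norm_le_zero_iff.1 h)

end IsIteratedExtension

/-- A bounded family of continuous multilinear forms converges pointwise along an ultrafilter to a
continuous multilinear form. -/
lemma exists_tendsto_apply_of_norm_le {n : ℕ}
    (f : I → ContinuousMultilinearMap 𝕜 (fun _ : Fin n => F) 𝕜) {C : ℝ} (hC : 0 ≤ C)
    (hf : ∀ i, ‖f i‖ ≤ C) :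
    ∃ g : ContinuousMultilinearMap 𝕜 (fun _ : Fin n => F) 𝕜,
      ‖g‖ ≤ C ∧ ∀ z, Tendsto (fun i => f i z) (𝔘 : Filter I) (𝓝 (g z)) := by
  have hb : ∀ z i, ‖f i z‖ ≤ C * ∏ l, ‖z l‖ :=
    fun z i => ContinuousMultilinearMap.le_of_opNorm_le (hf i) z
  have hex : ∀ z, ∃ a : 𝕜, Tendsto (fun i => f i z) (𝔘 : Filter I) (𝓝 a) := by
    intro z
    obtain ⟨a, -, ha⟩ := (isCompact_closedBall (0 : 𝕜) (C * ∏ l, ‖z l‖)).ultrafilter_le_nhds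
      (𝔘.map fun i => f i z)
      (le_principal_iff.2 <| mem_map.2 <| univ_mem' fun i => by simpa using hb z i)
    exact ⟨a, ha⟩
  choose g hg using hex
  let g' : MultilinearMap 𝕜 (fun _ : Fin n => F) 𝕜 :=
    { toFun := g
      map_update_add' := fun {_} m l x y => by
        refine tendsto_nhds_unique (hg _) ?_
        simpa only [ContinuousMultilinearMap.map_update_add] using
          (hg (Function.update m l x)).add (hg (Function.update m l y))
      map_update_smul' := fun {_} m l c x => by
        refine tendsto_nhds_unique (hg _) ?_
        simpa only [ContinuousMultilinearMap.map_update_smul] using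
          (hg (Function.update m l x)).const_smul c }
  have hg' : ∀ z, ‖g' z‖ ≤ C * ∏ l, ‖z l‖ := fun z =>
    le_of_tendsto (hg z).norm (Eventually.of_forall (hb z))
  exact ⟨g'.mkContinuous C hg', g'.mkContinuous_norm_le hC hg', hg⟩

/-- A bounded linear map into continuous multilinear forms extends to the ultrapower by
pointwise limits along the ultrafilter. -/
lemma exists_ultrapower_extension {n : ℕ}
    (T : E →ₗ[𝕜] ContinuousMultilinearMap 𝕜 (fun _ : Fin n => F) 𝕜) {C : ℝ} (hC : 0 ≤ C)
    (hTC : ∀ x, ‖T x‖ ≤ C * ‖x‖) :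
    ∃ S : Ultrapower 𝕜 I 𝔘 E →L[𝕜] ContinuousMultilinearMap 𝕜 (fun _ : Fin n => F) 𝕜,
      ∀ (y : BoundedFamilies I E) (z : Fin n → F),
        Tendsto (fun i => T (y i) z) (𝔘 : Filter I) (𝓝 (S (ultrapowerQuot 𝕜 I 𝔘 E y) z)) := by
  have hT : ∀ (y : BoundedFamilies I E) (i : I), ‖T (y i)‖ ≤ C * ‖y‖ := fun y i =>
    (hTC _).trans (mul_le_mul_of_nonneg_left (lp.norm_apply_le_norm ENNReal.top_ne_zero y i) hC)
  choose g hgn hg using fun y : BoundedFamilies I E =>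
    exists_tendsto_apply_of_norm_le (𝔘 := 𝔘) (fun i => T (y i)) (by positivity) (hT y)
  let L : BoundedFamilies I E →ₗ[𝕜] ContinuousMultilinearMap 𝕜 (fun _ : Fin n => F) 𝕜 :=
    { toFun := g
      map_add' := fun x y => by
        ext z
        refine tendsto_nhds_unique (hg _ z) ?_
        simpa using (hg x z).add (hg y z)
      map_smul' := fun c x => by
        ext z
        refine tendsto_nhds_unique (hg _ z) ?_
        simpa using (hg x z).const_smul c }
  refine ⟨(ultraNullSubmodule 𝕜 I 𝔘 E).liftQL (L.mkContinuous C hgn) ?_, hg⟩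
  intro y hy
  change g y = 0
  ext z
  refine tendsto_nhds_unique (hg y z) ?_
  have hy' : Tendsto (fun i => ‖y i‖) (𝔘 : Filter I) (𝓝 0) := hy
  refine squeeze_zero_norm (a := fun i => C * ‖y i‖ * ∏ l, ‖z l‖)
    (fun i => ContinuousMultilinearMap.le_of_opNorm_le (hTC (y i)) z) ?_
  simpa using (hy'.const_mul C).mul_const (∏ l, ‖z l‖)

lemma exists_continuousMultilinearMap_uncurryLeft {n : ℕ}
    (S : F →L[𝕜] ContinuousMultilinearMap 𝕜 (fun _ : Fin n => F) 𝕜) :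
    ∃ g : ContinuousMultilinearMap 𝕜 (fun _ : Fin (n + 1) => F) 𝕜,
      ∀ m, g m = S (m 0) (Fin.tail m) := by
  let g : MultilinearMap 𝕜 (fun _ : Fin (n + 1) => F) 𝕜 :=
    (ContinuousMultilinearMap.toMultilinearMapLinear ∘ₗ S.toLinearMap).uncurryLeft
  refine ⟨⟨g, ?_⟩, fun _ => rfl⟩
  change Continuous fun m : Fin (n + 1) → F => S (m 0) (fun l : Fin n => m l.succ)
  fun_prop

lemma exists_isIteratedExtension {n : ℕ}
    (A : ContinuousMultilinearMap 𝕜 (fun _ : Fin n => E) 𝕜) :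
    ∃ Abar : ContinuousMultilinearMap 𝕜 (fun _ : Fin n => Ultrapower 𝕜 I 𝔘 E) 𝕜,
      IsIteratedExtension A Abar := by
  induction n with
  | zero =>
    refine ⟨ContinuousMultilinearMap.constOfIsEmpty 𝕜 _ (A 0), fun x => ?_, fun j => j.elim0⟩
    simp [Subsingleton.elim x 0]
  | succ n ih =>
    choose B hB using fun x : E => ih (A.curryLeft x)
    let T : E →ₗ[𝕜] ContinuousMultilinearMap 𝕜 (fun _ : Fin n => Ultrapower 𝕜 I 𝔘 E) 𝕜 :=
      { toFun := B
        map_add' := fun x y => (hB (x + y)).unique (by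
          rw [map_add]
          exact (hB x).add (hB y))
        map_smul' := fun c x => (hB (c • x)).unique (by
          rw [map_smul]
          exact (hB x).smul c) }
    obtain ⟨S, hS⟩ := exists_ultrapower_extension (𝔘 := 𝔘) T (norm_nonneg A.curryLeft)
      fun x => (hB x).norm_le.trans (A.curryLeft.le_opNorm x)
    have hS' : ∀ (y : BoundedFamilies I E) z,
        Tendsto (fun i => B (y i) z) (𝔘 : Filter I) (𝓝 (S (ultrapowerQuot 𝕜 I 𝔘 E y) z)) := hS
    have hSB : ∀ x z, S (diagonalEmbedding 𝕜 I 𝔘 E x) z = B x z := fun x z =>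
      tendsto_nhds_unique (hS' (constFamily I x) z) tendsto_const_nhds
    obtain ⟨Abar, hAbar⟩ := exists_continuousMultilinearMap_uncurryLeft S
    refine ⟨Abar, fun x => ?_, fun j x y z => ?_⟩
    · rw [hAbar, hSB]
      refine ((hB (x 0)).1 (Fin.tail x)).trans ?_
      rw [ContinuousMultilinearMap.curryLeft_apply, Fin.cons_self_tail]
    · simp only [hAbar]
      cases j using Fin.cases with
      | zero =>
        simpa [hSB, Fin.tail_def] using hS' y (Fin.tail z)
      | succ j =>
        simpa [hSB, Fin.tail_def] using (hB (x 0)).2 j (Fin.tail x) y (Fin.tail z)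

end IteratedExtension

theorem iteratedExtension_existsUnique_and_isometric
    (𝕜 : Type*) [RCLike 𝕜] (I : Type*) [Nonempty I] (𝔘 : Ultrafilter I)
    (E : Type*) [NormedAddCommGroup E] [NormedSpace 𝕜 E] [CompleteSpace E]
    (n : ℕ) (hn : 1 ≤ n)
    (A : ContinuousMultilinearMap 𝕜 (fun _ : Fin n => E) 𝕜) :
    (∃! Abar : ContinuousMultilinearMap 𝕜 (fun _ : Fin n => Ultrapower 𝕜 I 𝔘 E) 𝕜,
      IsIteratedExtension A Abar) ∧
    (∀ Abar : ContinuousMultilinearMap 𝕜 (fun _ : Fin n => Ultrapower 𝕜 I 𝔘 E) 𝕜,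
      IsIteratedExtension A Abar → ‖Abar‖ = ‖A‖) := by
  obtain ⟨Abar, hAbar⟩ := exists_isIteratedExtension (𝔘 := 𝔘) A
  exact ⟨⟨Abar, hAbar, fun B hB => hB.unique hAbar⟩,
    fun B hB => le_antisymm hB.norm_le hB.le_norm⟩
end
end

section
/- Let E be a Banach space over 𝕜 (𝕜 = ℝ or ℂ), I a nonempty index set, 𝔘 an ultrafilter on I, n ≥ 1, and A : E^n → 𝕜 a continuous symmetric n-linear form; let P : E → 𝕜 be the associated continuous n-homogeneous polynomial P(x) = A(x, …, x). Let Ā : ((E)_𝔘)^n → 𝕜 be the iterated extension of A (the continuous n-linear form satisfying: (a) Ā(h_E x_1, …, h_E x_n) = A(x_1, …, x_n) for all x_1, …, x_n ∈ E; and (b) for every 1 ≤ j ≤ n, all x_1, …, x_{j−1} ∈ E, every bounded family y = (y_i)_{i∈I} in E, and all z_{j+1}, …, z_n ∈ (E)_𝔘, Ā(h_E x_1, …, h_E x_{j−1}, q_E y, z_{j+1}, …, z_n) = lim_{i,𝔘} Ā(h_E x_1, …, h_E x_{j−1}, h_E y_i, z_{j+1}, …, z_n)), and set P̄(z) := Ā(z,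 …, z) for z ∈ (E)_𝔘. Let M be a finite-dimensional subspace of (E)_𝔘, let z_1, …, z_r ∈ M and ε > 0. Then there exist a finite nonempty set 𝔉 and continuous linear operators R_i : M → E (i ∈ 𝔉) with ‖R_i‖ ≤ 1, such that |Σ_{k=1}^r P̄(z_k) − Σ_{k=1}^r P((1/|𝔉|) Σ_{i∈𝔉} R_i z_k)| < ε. -/
set_option synthInstance.maxHeartbeats 1000000
set_option maxHeartbeats 1000000

open Filter Topology ENNReal NormedSpace

noncomputable section

variable (𝕜 : Type*) [RCLike 𝕜]

/-- Along a nontrivial filter one can choose a sequence each of whose terms satisfies an eventual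
condition relative to the finitely many terms chosen before it. -/
theorem exists_seq_forall_strictMono {I κ : Type*} [Finite κ] (l : Filter I) [l.NeBot] {n : ℕ}
    {good : I → Prop} (hgood : ∀ᶠ i in l, good i) {G : κ → Fin n → (Fin n → I) → I → Prop}
    (hG : ∀ k p x, ∀ᶠ i in l, G k p x i) (i₀ : I) :
    ∃ s : ℕ → I, (∀ j, good (s j)) ∧ ∀ t : Fin n → ℕ, StrictMono t → ∀ k p,
      G k p (fun q => if q < p then s (t q) else i₀) (s (t p)) := by
  classical
  have hev : ∀ S : Finset I, ∃ i, good i ∧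
      ∀ k p, ∀ x ∈ Fintype.piFinset (fun _ : Fin n => S), G k p x i := by
    intro S
    refine (hgood.and (eventually_all.2 fun k => eventually_all.2 fun p =>
      (Filter.eventually_all_finset _).2 fun x _ => hG k p x)).exists
  choose g hg hgG using hev
  let T : ℕ → Finset I := fun m => Nat.rec {i₀} (fun _ S => insert (g S) S) m
  have hT : ∀ m, T (m + 1) = insert (g (T m)) (T m) := fun _ => rfl
  have hmono : Monotone T := monotone_nat_of_le_succ fun m => by
    rw [hT]; exact Finset.subset_insert _ _
  refine ⟨fun m => g (T m), fun _ => hg _, fun t ht k p => hgG _ k p _ ?_⟩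
  rw [Fintype.mem_piFinset]
  intro q
  split_ifs with hq
  · exact hmono (Nat.succ_le_of_lt (ht hq)) (hT _ ▸ Finset.mem_insert_self _ _)
  · exact hmono (Nat.zero_le _) (Finset.mem_singleton_self i₀)

/-- If a symmetric form is close to `a` on all strictly increasing selections from `v`, then
its diagonal value at the average of `v` is close to `a`, up to the proportion of non-injective
selections. -/
theorem norm_sub_apply_average_le {𝕜 E : Type*} [RCLike 𝕜] [NormedAddCommGroup E]
    [NormedSpace 𝕜 E] {n m : ℕ} (hm : 0 < m)
    (A : ContinuousMultilinearMap 𝕜 (fun _ : Fin n => E) 𝕜)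
    (hsymm : ∀ (σ : Equiv.Perm (Fin n)) (v : Fin n → E), A (fun j => v (σ j)) = A v)
    (v : Fin m → E) (a : 𝕜) {η C : ℝ} (hη : 0 ≤ η)
    (hC : ∀ t : Fin n → Fin m, ‖a - A (fun j => v (t j))‖ ≤ C)
    (hv : ∀ t : Fin n → Fin m, StrictMono t → ‖a - A (fun j => v (t j))‖ ≤ η) :
    ‖a - A (fun _ => (m : 𝕜)⁻¹ • ∑ i, v i)‖ ≤
      η + (1 - (m.descFactorial n : ℝ) / (m : ℝ) ^ n) * C := by
  classical
  have hm' : (0 : ℝ) < (m : ℝ) ^ n := by positivity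
  have hmk : ((m : 𝕜) ^ n) ≠ 0 := pow_ne_zero _ (Nat.cast_ne_zero.2 hm.ne')
  have hinj : ∀ t : Fin n → Fin m, t.Injective → ‖a - A (fun j => v (t j))‖ ≤ η := by
    intro t ht
    rw [← hsymm (Tuple.sort t) (fun j => v (t j))]
    exact hv (t ∘ Tuple.sort t) ((Tuple.monotone_sort t).strictMono_of_injective
      (ht.comp (Tuple.sort t).injective))
  have hexp : a - A (fun _ => (m : 𝕜)⁻¹ • ∑ i, v i) =
      ((m : 𝕜) ^ n)⁻¹ * ∑ t : Fin n → Fin m, (a - A (fun j => v (t j))) := by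
    rw [A.map_smul_univ (fun _ => (m : 𝕜)⁻¹) (fun _ => ∑ i, v i),
      A.map_sum (fun _ i => v i), Finset.sum_sub_distrib, mul_sub]
    simp [hmk]
  have hcard : (Finset.univ.filter fun t : Fin n → Fin m => t.Injective).card =
      m.descFactorial n := by
    rw [← Fintype.card_subtype, Fintype.card_congr (Equiv.subtypeInjectiveEquivEmbedding _ _),
      Fintype.card_embedding_eq]
    simp
  have hcard' : ((Finset.univ.filter fun t : Fin n → Fin m => ¬ t.Injective).card : ℝ) =
      (m : ℝ) ^ n - m.descFactorial n := by
    have := Finset.card_filter_add_card_filter_not (s := (Finset.univ : Finset (Fin n → Fin m)))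
      (fun t => t.Injective)
    rw [hcard, Finset.card_univ, Fintype.card_fun, Fintype.card_fin, Fintype.card_fin] at this
    rw [eq_sub_iff_add_eq']
    exact_mod_cast this
  have hsum : ‖∑ t : Fin n → Fin m, (a - A (fun j => v (t j)))‖ ≤
      m.descFactorial n * η + ((m : ℝ) ^ n - m.descFactorial n) * C := by
    refine (norm_sum_le _ _).trans ?_
    rw [← Finset.sum_filter_add_sum_filter_not Finset.univ (fun t => t.Injective)]
    refine add_le_add ?_ ?_
    · refine (Finset.sum_le_card_nsmul _ _ η fun t ht => ?_).trans_eq ?_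
      · exact hinj t (Finset.mem_filter.1 ht).2
      · rw [hcard, nsmul_eq_mul]
    · refine (Finset.sum_le_card_nsmul _ _ C fun t _ => hC t).trans_eq ?_
      rw [nsmul_eq_mul, hcard']
  have hle : (m.descFactorial n : ℝ) ≤ (m : ℝ) ^ n := by
    exact_mod_cast Nat.descFactorial_le_pow m n
  rw [hexp, norm_mul, norm_inv, norm_pow, RCLike.norm_natCast, inv_mul_le_iff₀ hm']
  refine hsum.trans ?_
  have h1 : (m : ℝ) ^ n * (η + (1 - (m.descFactorial n : ℝ) / (m : ℝ) ^ n) * C) =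
      (m : ℝ) ^ n * η + ((m : ℝ) ^ n - m.descFactorial n) * C := by
    field_simp
  rw [h1]
  gcongr

theorem tendsto_descFactorial_div_pow (n : ℕ) :
    Tendsto (fun m : ℕ => (m.descFactorial n : ℝ) / (m : ℝ) ^ n) atTop (𝓝 1) := by
  have hlow : Tendsto (fun m : ℕ => (((m + 1 - n : ℕ) : ℝ) / m) ^ n) atTop (𝓝 1) := by
    have h1 : Tendsto (fun m : ℕ => 1 + (1 - (n : ℝ)) / (m : ℝ)) atTop (𝓝 1) := by
      simpa using (tendsto_const_div_atTop_nhds_zero_nat (1 - (n : ℝ))).const_add 1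
    have h2 : Tendsto (fun m : ℕ => ((m + 1 - n : ℕ) : ℝ) / m) atTop (𝓝 1) := by
      refine h1.congr' ?_
      filter_upwards [eventually_ge_atTop n, eventually_gt_atTop 0] with m hm hm0
      have : (0 : ℝ) < m := by exact_mod_cast hm0
      rw [Nat.cast_sub (by omega)]
      push_cast
      field_simp
      ring
    simpa using h2.pow n
  refine tendsto_of_tendsto_of_tendsto_of_le_of_le hlow tendsto_const_nhds (fun m => ?_)
    (fun m => ?_)
  · simp only [div_pow]
    gcongr
    rw [← Nat.cast_pow, Nat.cast_le]
    exact Nat.pow_sub_le_descFactorial m n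
  · refine div_le_one_of_le₀ ?_ (by positivity)
    rw [← Nat.cast_pow, Nat.cast_le]
    exact Nat.descFactorial_le_pow m n

/-- If the coordinates of a linear map from a finite-dimensional space into a space of bounded
families are eventually almost contractive at each point, then they are so uniformly. -/
theorem eventually_forall_norm_apply_le {𝕜 M E I : Type*} [RCLike 𝕜] [SeminormedAddCommGroup M]
    [NormedSpace 𝕜 M] [FiniteDimensional 𝕜 M] [NormedAddCommGroup E] [NormedSpace 𝕜 E]
    (hsep : ∀ w : M, ‖w‖ = 0 → w = 0) (l : Filter I) (Y : M →ₗ[𝕜] BoundedFamilies I E)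
    (hY : ∀ w, ∀ δ > 0, ∀ᶠ i in l, ‖Y w i‖ ≤ ‖w‖ + δ) {δ : ℝ} (hδ : 0 < δ) :
    ∀ᶠ i in l, ∀ w, ‖Y w i‖ ≤ (1 + δ) * ‖w‖ := by
  let : NormedAddCommGroup M := NormedAddCommGroup.ofSeparation hsep
  have : ProperSpace M := FiniteDimensional.proper 𝕜 M
  let Yc : M →L[𝕜] BoundedFamilies I E := LinearMap.toContinuousLinearMap Y
  have hK : ∀ i w, ‖Y w i‖ ≤ ‖Yc‖ * ‖w‖ := fun i w =>
    (lp.norm_apply_le_norm ENNReal.top_ne_zero (Y w) i).trans (Yc.le_opNorm w)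
  obtain ⟨t, ht, htf, hcov⟩ := (isCompact_sphere (0 : M) 1).finite_cover_balls
    (e := δ / (2 * (‖Yc‖ + 1))) (by positivity)
  filter_upwards [htf.eventually_all.2 fun w _ => hY w (δ / 2) (by positivity)] with i hi
  let L : M →L[𝕜] E := (lp.evalCLM 𝕜 (fun _ : I => E) ⊤ i).comp Yc
  have hL : ‖L‖ ≤ 1 + δ := by
    refine ContinuousLinearMap.opNorm_le_of_unit_norm (by positivity) fun x hx => ?_
    obtain ⟨w, hw, hxw⟩ := Set.mem_iUnion₂.1 (hcov (mem_sphere_zero_iff_norm.2 hx))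
    have hw1 : ‖w‖ = 1 := mem_sphere_zero_iff_norm.1 (ht hw)
    rw [Metric.mem_ball, dist_eq_norm] at hxw
    have h1 : ‖L (x - w)‖ ≤ δ / 2 := by
      refine (hK i (x - w)).trans ((mul_le_mul_of_nonneg_left hxw.le (norm_nonneg _)).trans ?_)
      rw [mul_div_assoc', div_le_div_iff₀ (by positivity) (by positivity)]
      nlinarith [norm_nonneg Yc]
    have h2 : ‖L w‖ ≤ ‖w‖ + δ / 2 := hi w hw
    calc ‖L x‖ = ‖L (x - w) + L w‖ := by rw [← map_add, sub_add_cancel]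
      _ ≤ ‖L (x - w)‖ + ‖L w‖ := norm_add_le _ _
      _ ≤ 1 + δ := by linarith
  exact fun w => L.le_of_opNorm_le hL w

section Ultrapower

variable {𝕜 : Type*} [RCLike 𝕜] {I : Type*} {𝔘 : Ultrafilter I} {E : Type*}
  [NormedAddCommGroup E] [NormedSpace 𝕜 E]

theorem eventually_norm_apply_le_norm_ultrapowerQuot (y : BoundedFamilies I E) {δ : ℝ}
    (hδ : 0 < δ) :
    ∀ᶠ i in (𝔘 : Filter I), ‖y i‖ ≤ ‖ultrapowerQuot 𝕜 I 𝔘 E y‖ + δ := by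
  obtain ⟨y', hy', hn⟩ := Submodule.Quotient.norm_mk_lt (ultrapowerQuot 𝕜 I 𝔘 E y) (half_pos hδ)
  have hnull : Tendsto (fun i => ‖(y - y') i‖) (𝔘 : Filter I) (𝓝 0) :=
    (Submodule.Quotient.eq (ultraNullSubmodule 𝕜 I 𝔘 E)).1 hy'.symm
  filter_upwards [hnull.eventually_lt_const (half_pos hδ)] with i hi
  have h1 : ‖y i‖ ≤ ‖(y - y') i‖ + ‖y' i‖ := by
    simpa [lp.coeFn_sub] using norm_add_le ((y - y') i) (y' i)
  have h2 : ‖y' i‖ ≤ ‖y'‖ := lp.norm_apply_le_norm ENNReal.top_ne_zero y' i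
  linarith

theorem eq_zero_of_norm_eq_zero_ultrapower (w : Ultrapower 𝕜 I 𝔘 E) (hw : ‖w‖ = 0) : w = 0 := by
  obtain ⟨y, rfl⟩ := Submodule.Quotient.mk_surjective _ w
  refine (Submodule.Quotient.mk_eq_zero _).2 ?_
  change Tendsto (fun i => ‖y i‖) (𝔘 : Filter I) (𝓝 0)
  rw [Metric.tendsto_nhds]
  intro δ hδ
  filter_upwards [eventually_norm_apply_le_norm_ultrapowerQuot (𝕜 := 𝕜) (𝔘 := 𝔘) y
    (half_pos hδ)] with i hi
  have hw : ‖ultrapowerQuot 𝕜 I 𝔘 E y‖ = 0 := hw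
  rw [dist_zero_right, norm_norm]
  linarith

/-- A finite-dimensional subspace of the ultrapower lifts linearly to bounded families whose
coordinates are eventually almost contractive. -/
theorem exists_lift_eventually_norm_apply_le (M : Submodule 𝕜 (Ultrapower 𝕜 I 𝔘 E))
    [FiniteDimensional 𝕜 M] :
    ∃ Y : M →ₗ[𝕜] BoundedFamilies I E, (∀ w, ultrapowerQuot 𝕜 I 𝔘 E (Y w) = w) ∧
      ∀ δ > 0, ∀ᶠ i in (𝔘 : Filter I), ∀ w, ‖Y w i‖ ≤ (1 + δ) * ‖w‖ := by
  obtain ⟨s, hs⟩ := (ultraNullSubmodule 𝕜 I 𝔘 E).mkQ.exists_rightInverse_of_surjective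
    (Submodule.range_mkQ _)
  have hY : ∀ w : M, ultrapowerQuot 𝕜 I 𝔘 E ((s ∘ₗ M.subtype) w) = w :=
    fun w => LinearMap.congr_fun hs (w : Ultrapower 𝕜 I 𝔘 E)
  refine ⟨s ∘ₗ M.subtype, hY, fun δ hδ => eventually_forall_norm_apply_le
    (fun w hw => Subtype.ext (eq_zero_of_norm_eq_zero_ultrapower _ hw)) (𝔘 : Filter I) _
    (fun w δ hδ => ?_) hδ⟩
  have := eventually_norm_apply_le_norm_ultrapowerQuot (𝕜 := 𝕜) (𝔘 := 𝔘)
    ((s ∘ₗ M.subtype) w) hδ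
  rw [hY] at this
  exact this

/-- Iterated limits allow choosing a sequence of indices all of whose strictly increasing
selections approximate the iterated extension on the diagonal, for finitely many points. -/
theorem exists_seq_norm_iteratedExtension_sub_le {κ : Type*} [Finite κ] {n : ℕ}
    {A : ContinuousMultilinearMap 𝕜 (fun _ : Fin n => E) 𝕜}
    {Abar : ContinuousMultilinearMap 𝕜 (fun _ : Fin n => Ultrapower 𝕜 I 𝔘 E) 𝕜}
    (hAbar : IsIteratedExtension A Abar) {good : I → Prop}
    (hgood : ∀ᶠ i in (𝔘 : Filter I), good i) (y : κ → BoundedFamilies I E) {η : ℝ} (hη : 0 < η) :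
    ∃ s : ℕ → I, (∀ j, good (s j)) ∧ ∀ t : Fin n → ℕ, StrictMono t → ∀ k,
      ‖Abar (fun _ => ultrapowerQuot 𝕜 I 𝔘 E (y k)) - A (fun j => y k (s (t j)))‖ ≤ n * η := by
  obtain ⟨i₀, -⟩ := hgood.exists
  let h := diagonalEmbedding 𝕜 I 𝔘 E
  let q := ultrapowerQuot 𝕜 I 𝔘 E
  obtain ⟨s, hs, hsG⟩ := exists_seq_forall_strictMono (𝔘 : Filter I) hgood
    (G := fun k (p : Fin n) x i => dist
      (Abar (fun l => if l < p then h (y k (x l)) else if l = p then h (y k i) else q (y k)))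
      (Abar (fun l => if l < p then h (y k (x l)) else if l = p then q (y k) else q (y k))) < η)
    (fun k p x => (hAbar.2 p (fun l => y k (x l)) (y k) (fun _ => q (y k))).eventually
      (Metric.ball_mem_nhds _ hη)) i₀
  refine ⟨s, hs, fun t ht k => ?_⟩
  let f : ℕ → 𝕜 := fun p => Abar (fun l => if (l : ℕ) < p then h (y k (s (t l))) else q (y k))
  have hstep : ∀ p, p < n → dist (f p) (f (p + 1)) ≤ η := by
    intro p hp
    have := hsG t ht k ⟨p, hp⟩
    rw [dist_comm]
    refine le_of_eq_of_le ?_ this.le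
    refine congrArg₂ dist (congrArg Abar (funext fun l => ?_))
      (congrArg Abar (funext fun l => ?_))
    · simp only [Fin.lt_def, Fin.ext_iff]
      rcases lt_trichotomy (l : ℕ) p with hl | hl | hl
      · simp [hl, hl.trans (Nat.lt_succ_self p)]
      · have : l = ⟨p, hp⟩ := Fin.ext hl
        subst this
        simp
      · simp [hl.ne', not_lt.2 hl.le, not_lt.2 (Nat.succ_le_of_lt hl)]
    · simp only [Fin.lt_def, ite_self]
      split_ifs <;> rfl
  have htel := dist_le_range_sum_of_dist_le (f := f) (d := fun _ => η) n (fun {p} hp => hstep p hp)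
  have h0 : f 0 = Abar (fun _ => q (y k)) := by simp [f]
  have hn : f n = A (fun j => y k (s (t j))) := by
    rw [← hAbar.1]
    simp [f, h]
  rw [h0, hn, dist_eq_norm] at htel
  simpa using htel

/-- Averages of finitely many coordinates of representatives approximate the diagonal of the
iterated extension. -/
theorem exists_average_norm_iteratedExtension_sub_le {κ : Type*} [Finite κ] {n : ℕ}
    {A : ContinuousMultilinearMap 𝕜 (fun _ : Fin n => E) 𝕜}
    (hsymm : ∀ (σ : Equiv.Perm (Fin n)) (v : Fin n → E), A (fun j => v (σ j)) = A v)
    {Abar : ContinuousMultilinearMap 𝕜 (fun _ : Fin n => Ultrapower 𝕜 I 𝔘 E) 𝕜}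
    (hAbar : IsIteratedExtension A Abar) {good : I → Prop}
    (hgood : ∀ᶠ i in (𝔘 : Filter I), good i) (y : κ → BoundedFamilies I E) {η : ℝ} (hη : 0 < η) :
    ∃ m : ℕ, 0 < m ∧ ∃ s : Fin m → I, (∀ j, good (s j)) ∧ ∀ k,
      ‖Abar (fun _ => ultrapowerQuot 𝕜 I 𝔘 E (y k)) -
        A (fun _ => (m : 𝕜)⁻¹ • ∑ i, y k (s i))‖ ≤ η := by
  obtain ⟨s, hs, hsA⟩ := exists_seq_norm_iteratedExtension_sub_le hAbar hgood y
    (η := η / (2 * (n + 1))) (by positivity)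
  let C : κ → ℝ := fun k => ‖Abar (fun _ => ultrapowerQuot 𝕜 I 𝔘 E (y k))‖ + ‖A‖ * ‖y k‖ ^ n
  have hlim : ∀ k, ∀ᶠ m : ℕ in atTop,
      (1 - (m.descFactorial n : ℝ) / (m : ℝ) ^ n) * C k < η / 2 := by
    intro k
    have := ((tendsto_descFactorial_div_pow n).const_sub 1).mul_const (C k)
    rw [sub_self, zero_mul] at this
    exact this.eventually_lt_const (half_pos hη)
  obtain ⟨m, hm, hm0⟩ := ((eventually_all.2 hlim).and (eventually_gt_atTop 0)).exists
  refine ⟨m, hm0, fun i => s i, fun j => hs j, fun k => ?_⟩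
  refine (norm_sub_apply_average_le hm0 A hsymm (fun i : Fin m => y k (s i)) _ (η := η / 2)
    (C := C k) (by positivity) (fun t => ?_) fun t ht => ?_).trans ?_
  · refine (norm_sub_le _ _).trans (add_le_add le_rfl ?_)
    refine (A.le_opNorm _).trans ?_
    refine mul_le_mul_of_nonneg_left ?_ (norm_nonneg _)
    refine (Finset.prod_le_prod (fun _ _ => norm_nonneg _)
      (g := fun _ : Fin n => ‖y k‖) fun j _ => ?_).trans_eq (by simp)
    exact lp.norm_apply_le_norm ENNReal.top_ne_zero (y k) _
  · refine (hsA (fun j => t j) ht k).trans ?_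
    rw [mul_div_assoc', div_le_div_iff₀ (by positivity) (by positivity)]
    nlinarith
  · linarith [hm k]

end Ultrapower

theorem exists_finite_averaging_operators_approximating_iterated_polynomial_extension
    (𝕜 : Type*) [RCLike 𝕜] (I : Type*) [Nonempty I] (𝔘 : Ultrafilter I)
    (E : Type*) [NormedAddCommGroup E] [NormedSpace 𝕜 E] [CompleteSpace E]
    (n : ℕ) (hn : 1 ≤ n)
    (A : ContinuousMultilinearMap 𝕜 (fun _ : Fin n => E) 𝕜)
    (hsymm : ∀ (σ : Equiv.Perm (Fin n)) (v : Fin n → E), A (fun j => v (σ j)) = A v)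
    (P : E → 𝕜) (hP : ∀ x : E, P x = A (fun _ => x))
    (Abar : ContinuousMultilinearMap 𝕜 (fun _ : Fin n => Ultrapower 𝕜 I 𝔘 E) 𝕜)
    (hAbar : IsIteratedExtension A Abar)
    (Pbar : Ultrapower 𝕜 I 𝔘 E → 𝕜) (hPbar : ∀ w, Pbar w = Abar (fun _ => w))
    (M : Submodule 𝕜 (Ultrapower 𝕜 I 𝔘 E)) [FiniteDimensional 𝕜 M]
    (r : ℕ) (z : Fin r → M) (ε : ℝ) (hε : 0 < ε) :
    ∃ m : ℕ, 0 < m ∧ ∃ R : Fin m → (M →L[𝕜] E),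
      (∀ i, ‖R i‖ ≤ 1) ∧
      ‖(∑ k : Fin r, Pbar (z k : Ultrapower 𝕜 I 𝔘 E)) -
        ∑ k : Fin r, P ((m : 𝕜)⁻¹ • ∑ i : Fin m, R i (z k))‖ < ε := by
  obtain ⟨Y, hY, hL⟩ := exists_lift_eventually_norm_apply_le M
  set S : 𝕜 := ∑ k : Fin r, Pbar (z k : Ultrapower 𝕜 I 𝔘 E) with hS
  have hc : Tendsto (fun δ : ℝ => |1 - ((1 + δ)⁻¹) ^ n| * ‖S‖) (𝓝[>] 0) (𝓝 0) := by
    have : ContinuousAt (fun δ : ℝ => |1 - ((1 + δ)⁻¹) ^ n| * ‖S‖) 0 := by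
      fun_prop (disch := norm_num)
    simpa [ContinuousAt] using this.tendsto.mono_left nhdsWithin_le_nhds
  obtain ⟨δ, hδS, hδ⟩ := ((hc.eventually_lt_const (half_pos hε)).and
    self_mem_nhdsWithin).exists
  have hδ : 0 < δ := hδ
  obtain ⟨m, hm, s, hs, hsP⟩ := exists_average_norm_iteratedExtension_sub_le hsymm hAbar
    (hL δ hδ) (fun k : Fin r => Y (z k)) (η := ε / (2 * (r + 1))) (by positivity)
  set c : ℝ := (1 + δ)⁻¹ with hcdef
  have hc0 : 0 ≤ c := by positivity
  have hc1 : c ≤ 1 := inv_le_one_of_one_le₀ (by linarith)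
  have hR : ∀ i : Fin m, ∃ R : M →L[𝕜] E, (∀ w, R w = (c : 𝕜) • Y w (s i)) ∧ ‖R‖ ≤ 1 := by
    intro i
    have hbound : ∀ w,
        ‖((c : 𝕜) • (lp.evalₗ (𝕜 := 𝕜) (fun _ : I => E) ⊤ (s i) ∘ₗ Y)) w‖ ≤ 1 * ‖w‖ := by
      intro w
      change ‖(c : 𝕜) • Y w (s i)‖ ≤ _
      rw [norm_smul, RCLike.norm_of_nonneg hc0, hcdef, inv_mul_le_iff₀ (by positivity), one_mul]
      exact hs i w
    exact ⟨LinearMap.mkContinuous _ 1 hbound, fun _ => rfl,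
      LinearMap.mkContinuous_norm_le _ zero_le_one hbound⟩
  choose R hRY hR1 using hR
  refine ⟨m, hm, R, hR1, ?_⟩
  set T : 𝕜 := ∑ k : Fin r, A (fun _ => (m : 𝕜)⁻¹ • ∑ i, Y (z k) (s i)) with hT
  have hPT : ∑ k : Fin r, P ((m : 𝕜)⁻¹ • ∑ i : Fin m, R i (z k)) =
      ((c : 𝕜)) ^ n * T := by
    rw [hT, Finset.mul_sum]
    refine Finset.sum_congr rfl fun k _ => ?_
    have := A.map_smul_univ (fun _ => (c : 𝕜)) (fun _ => (m : 𝕜)⁻¹ • ∑ i, Y (z k) (s i))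
    rw [Finset.prod_const, Finset.card_univ, Fintype.card_fin, smul_eq_mul] at this
    rw [hP, ← this]
    simp only [hRY, ← Finset.smul_sum, smul_comm (c : 𝕜)]
  have hST : ‖S - T‖ ≤ ε / 2 := by
    rw [hS, hT, ← Finset.sum_sub_distrib]
    refine (norm_sum_le_of_le _ fun k _ => ?_).trans (b := ∑ _k : Fin r, ε / (2 * (r + 1))) ?_
    · have := hsP k
      rw [hY] at this
      rw [hPbar]
      exact this
    · rw [Finset.sum_const, Finset.card_univ, Fintype.card_fin, nsmul_eq_mul, mul_div_assoc',
        div_le_div_iff₀ (by positivity) (by positivity)]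
      nlinarith
  rw [hPT]
  have hsplit : S - (c : 𝕜) ^ n * T = ((1 - c ^ n : ℝ) : 𝕜) * S + ((c ^ n : ℝ) : 𝕜) * (S - T) := by
    push_cast
    ring
  have hcn : c ^ n ≤ 1 := pow_le_one₀ hc0 hc1
  have h2 : ‖((c ^ n : ℝ) : 𝕜) * (S - T)‖ ≤ ε / 2 := by
    rw [norm_mul, RCLike.norm_of_nonneg (by positivity)]
    exact (mul_le_of_le_one_left (norm_nonneg _) hcn).trans hST
  have h1 : ‖((1 - c ^ n : ℝ) : 𝕜) * S‖ < ε / 2 := by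
    rw [norm_mul, RCLike.norm_ofReal]
    exact hδS
  rw [hsplit]
  linarith [norm_add_le (((1 - c ^ n : ℝ) : 𝕜) * S) (((c ^ n : ℝ) : 𝕜) * (S - T))]
end
end
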